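/- arXiv:0807.4103 — 2 statements merged into one kernel-verified Lean document; each statement's English description precedes it below -/
import Mathlib

section
/- Let n ∈ ℕ, n ≥ 1. If f : [a, b] → ℝ is 2n-convex, x₁ < … < x_n are points of the open interval (a, b), and x_{n+1} = b, then there exists a polynomial p ∈ Π_{2n} such that p(x_i) = f(x_i) for i = 1, …, n+1, and p(x) ≥ f(x) for all x ∈ [a, b]. -/
/-- Divided differences of `f` at the points of a list, defined recursively:
`[x₁; f] = f x₁` and
`[x₁, …, x_{k+1}; f] = ([x₂, …, x_{k+1}; f] − [x₁, …, x_k; f]) / (x_{k+1} − x₁)`. -/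
noncomputable def divDiff (f : ℝ → ℝ) : List ℝ → ℝ
  | [] => 0
  | [x] => f x
  | x :: y :: l =>
      (divDiff f (y :: l) - divDiff f (x :: (y :: l).dropLast)) /
        ((y :: l).getLast (List.cons_ne_nil y l) - x)
termination_by l => l.length
decreasing_by
  all_goals simp [List.length_dropLast]

/-- A function `f` is `n`-convex on a set `I` if all its `(n+2)`-point divided
differences at distinct points of `I` are nonnegative. -/
def NConvexOn (n : ℕ) (I : Set ℝ) (f : ℝ → ℝ) : Prop :=
  ∀ l : List ℝ, l.length = n + 2 → l.Nodup → (∀ x ∈ l, x ∈ I) → 0 ≤ divDiff f l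

open Polynomial Filter Topology

/-- The divided difference of `f` at distinct points is the top coefficient of the polynomial
interpolating `f` there. -/
theorem divDiff_eq_coeff_interpolate (f : ℝ → ℝ) (l : List ℝ) (hl : l.Nodup) (hne : l ≠ []) :
    divDiff f l = (Lagrange.interpolate l.toFinset id f).coeff (l.length - 1) := by
  induction h : l.length using Nat.strong_induction_on generalizing l with
  | _ k ih =>
  match l, hl, hne with
  | [x], _, _ =>
    subst h
    simp [divDiff]
  | x :: y :: t, hl, _ =>
    have hd : (y :: t).dropLast ++ [(y :: t).getLast (by simp)] = y :: t :=
      List.dropLast_append_getLast _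
    set z := (y :: t).getLast (by simp) with hz
    set u := (y :: t).dropLast with hu
    have hlen : u.length = t.length := by simp [hu]
    have hl' : (x :: u ++ [z]).Nodup := by simpa [hd] using hl
    have hxu : (x :: u).Nodup := (List.nodup_append.1 hl').1
    have hyt : (y :: t).Nodup := (List.nodup_cons.1 hl).2
    have hxz : x ≠ z := by
      rintro rfl
      simp at hl'
    have hxyt : x ∉ y :: t := (List.nodup_cons.1 hl).1
    have hzu : z ∉ x :: u := fun hm => (List.disjoint_of_nodup_append hl') hm (by simp)
    have e1 : (x :: y :: t).toFinset.erase x = (y :: t).toFinset := by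
      rw [List.toFinset_cons, Finset.erase_insert]; simpa using hxyt
    have e2 : (x :: y :: t).toFinset.erase z = (x :: u).toFinset := by
      rw [← hd, ← List.cons_append, List.toFinset_append]
      ext w
      simp only [Finset.mem_erase, Finset.mem_union, List.mem_toFinset, List.mem_singleton]
      constructor
      · tauto
      · intro hw
        exact ⟨fun e => hzu (e ▸ hw), Or.inl hw⟩
    have hk : k = t.length + 1 + 1 := by simpa using h.symm
    have i1 := ih (t.length + 1) (by omega) (y :: t) hyt (by simp) (by simp)
    have i2 := ih (t.length + 1) (by omega) (x :: u) hxu (by simp) (by simp [hlen])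
    have hc (v : List ℝ) (hv : v.length = t.length + 1) :
        (Lagrange.interpolate v.toFinset id f).coeff (t.length + 1) = 0 := by
      apply coeff_eq_zero_of_degree_lt
      refine (Lagrange.degree_interpolate_lt _ Function.injective_id.injOn).trans_le ?_
      exact_mod_cast hv ▸ List.toFinset_card_le v
    have hc1 := hc (y :: t) (by simp)
    have hc2 := hc (x :: u) (by simp [hlen])
    rw [divDiff, i1, i2, Lagrange.interpolate_eq_add_interpolate_erase
      (s := (x :: y :: t).toFinset) (i := x) (j := z) f
      Function.injective_id.injOn (by simp) (by rw [← hd]; simp) hxz, e1, e2, hk]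
    simp only [Lagrange.basisDivisor, id, Nat.add_sub_cancel, coeff_add]
    have hm (Q : ℝ[X]) (c d : ℝ) (hQ : Q.coeff (t.length + 1) = 0) :
        (Q * (C c * (X - C d))).coeff (t.length + 1) = c * Q.coeff t.length := by
      rw [← mul_assoc, mul_comm Q, mul_assoc, coeff_C_mul, mul_sub, coeff_sub, coeff_mul_X,
        coeff_mul_C, hQ]
      ring
    rw [hm _ _ _ hc1, hm _ _ _ hc2]
    have : z - x ≠ 0 := sub_ne_zero.2 hxz.symm
    have : x - z ≠ 0 := sub_ne_zero.2 hxz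
    rw [← hz]
    field_simp
    ring

/-- The sign of the interpolation error of an `m`-convex function at `m + 1` distinct nodes. -/
theorem NConvexOn.mul_prod_nonneg {m : ℕ} {I : Set ℝ} {f : ℝ → ℝ} (hf : NConvexOn m I f)
    {ι : Type*} [Fintype ι] {v : ι → ℝ} (hv : Function.Injective v)
    (hcard : Fintype.card ι = m + 1) (hvI : ∀ i, v i ∈ I) {P : ℝ[X]} (hP : P.natDegree ≤ m)
    (hPv : ∀ i, P.eval (v i) = f (v i)) {y : ℝ} (hy : y ∈ I) (hyv : ∀ i, y ≠ v i) :
    0 ≤ (f y - P.eval y) * ∏ i, (y - v i) := by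
  classical
  set s : Finset ℝ := Finset.univ.image v with hs
  have hsc : s.card = m + 1 := by
    rw [hs, Finset.card_image_of_injective _ hv, Finset.card_univ, hcard]
  have hys : y ∉ s := by simpa [hs, eq_comm] using hyv
  set W := ∏ i, (y - v i) with hW
  have hW0 : W ≠ 0 := Finset.prod_ne_zero_iff.2 fun i _ => sub_ne_zero.2 (hyv i)
  have hnod : (Lagrange.nodal s id).eval y = W := by
    rw [Lagrange.eval_nodal, hs, Finset.prod_image (fun i _ j _ h => hv h)]
    rfl
  set c := (f y - P.eval y) / W with hc
  set Q := P + C c * Lagrange.nodal s id with hQ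
  have hdn : (Lagrange.nodal s (id : ℝ → ℝ)).natDegree = m + 1 := by
    rw [Lagrange.natDegree_nodal, hsc]
  have hQeq : Q = Lagrange.interpolate (insert y s) id f := by
    refine Lagrange.eq_interpolate_of_eval_eq f Function.injective_id.injOn ?_ ?_
    · rw [Finset.card_insert_of_notMem hys, hsc]
      have : Q.natDegree < m + 1 + 1 :=
        (natDegree_add_le _ _).trans_lt
          (max_lt (by omega) ((natDegree_C_mul_le _ _).trans_lt (by omega)))
      exact degree_le_natDegree.trans_lt (by exact_mod_cast this)
    · intro t ht
      rcases Finset.mem_insert.1 ht with rfl | ht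
      · simp only [hQ, id, eval_add, eval_mul, eval_C, hnod, hc]
        field_simp
        ring
      · obtain ⟨i, -, rfl⟩ := Finset.mem_image.1 ht
        have : (Lagrange.nodal s id).eval (v i) = 0 := Lagrange.eval_nodal_at_node (v := id) ht
        simp [hQ, this, hPv]
  have hcoeff : Q.coeff (m + 1) = c := by
    have h1 : (Lagrange.nodal s (id : ℝ → ℝ)).coeff (m + 1) = 1 := by
      rw [← hdn]; exact Lagrange.nodal_monic
    rw [hQ, coeff_add, coeff_C_mul, h1, coeff_eq_zero_of_natDegree_lt (by omega)]
    ring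
  have hlen : (insert y s).toList.length = m + 2 := by
    rw [Finset.length_toList, Finset.card_insert_of_notMem hys, hsc]
  have key := hf (insert y s).toList hlen (Finset.nodup_toList _) (by
    intro t ht
    rw [Finset.mem_toList, Finset.mem_insert] at ht
    rcases ht with rfl | ht
    · exact hy
    · obtain ⟨i, -, rfl⟩ := Finset.mem_image.1 ht
      exact hvI i)
  rw [divDiff_eq_coeff_interpolate f _ (Finset.nodup_toList _) (by
    intro h; simp [h] at hlen), Finset.toList_toFinset, ← hQeq, hlen] at key
  have hc0 : 0 ≤ c := by rw [← hcoeff]; exact key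
  have : (f y - P.eval y) * W = c * (W * W) := by rw [hc]; field_simp
  rw [this]
  exact mul_nonneg hc0 (mul_self_nonneg W)

theorem exists_natDegree_le_eval_eq {ι : Type*} [Fintype ι] {v : ι → ℝ}
    (hv : Function.Injective v) {m : ℕ} (hcard : Fintype.card ι = m + 1) (r : ι → ℝ) :
    ∃ P : ℝ[X], P.natDegree ≤ m ∧ ∀ i, P.eval (v i) = r i := by
  classical
  refine ⟨Lagrange.interpolate Finset.univ v r, ?_, fun i =>
    Lagrange.eval_interpolate_at_node r hv.injOn (Finset.mem_univ i)⟩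
  refine natDegree_le_of_degree_le ((Lagrange.degree_interpolate_le r hv.injOn).trans ?_)
  simp [Finset.card_univ, hcard]

theorem exists_eval_sub_eq_mul {P : ℝ[X]} {c z : ℝ} (h : P.eval c = z) :
    ∃ Q : ℝ[X], ∀ y, P.eval y - z = (y - c) * Q.eval y := by
  obtain ⟨Q, hQ⟩ := dvd_iff_isRoot.2 (show IsRoot (P - C z) c by simp [h])
  refine ⟨Q, fun y => ?_⟩
  simpa using congrArg (eval y) hQ

theorem tendsto_eval_add_nhds_zero (Q : ℝ[X]) (c : ℝ) {F : Filter ℝ} (hF : F ≤ 𝓝[>] 0) :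
    Tendsto (fun h => Q.eval (c + h)) F (𝓝 (Q.eval c)) := by
  have : Tendsto (fun h => Q.eval (c + h)) (𝓝 0) (𝓝 (Q.eval (c + 0))) :=
    (Q.continuous.comp (continuous_const.add continuous_id)).tendsto 0
  rw [add_zero] at this
  exact this.mono_left (hF.trans nhdsWithin_le_nhds)

/-- Along an ultrafilter, the right difference quotients of an `m`-convex function, `m ≥ 1`,
converge at every interior point. -/
theorem NConvexOn.exists_tendsto_slope {m : ℕ} (hm : 1 ≤ m) {a b c : ℝ} {f : ℝ → ℝ}
    (hf : NConvexOn m (Set.Icc a b) f) (hc : c ∈ Set.Ioo a b) (U : Ultrafilter ℝ)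
    (hU : (U : Filter ℝ) ≤ 𝓝[>] 0) :
    ∃ d, Tendsto (fun h => (f (c + h) - f c) / h) U (𝓝 d) := by
  obtain ⟨hac, hcb⟩ := hc
  set ε := (c - a) / (m + 1) with hε
  have hε0 : 0 < ε := div_pos (by linarith) (by positivity)
  have hεm : (m + 1) * ε = c - a := by rw [hε]; field_simp
  set w : ℕ → ℝ := fun i => c - i * ε with hw
  have hwc (i) : w i ≤ c := by
    have : 0 ≤ (i : ℝ) * ε := by positivity
    simp only [hw]; linarith
  have hwI (i : ℕ) (hi : i ≤ m) : w i ∈ Set.Icc a b := by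
    have : (i : ℝ) * ε ≤ (m + 1) * ε := by
      have : (i : ℝ) ≤ m := by exact_mod_cast hi
      gcongr; linarith
    refine ⟨?_, (hwc i).trans hcb.le⟩
    simp only [hw]; linarith
  have hwinj : Function.Injective w := by
    intro i j hij
    have : (i : ℝ) * ε = j * ε := by simp only [hw] at hij; linarith
    exact_mod_cast mul_right_cancel₀ hε0.ne' this
  have hw0 : w 0 = c := by simp [hw]
  let v₁ : Fin (m + 1) → ℝ := fun i => w i
  let v₂ : Option (Fin m) → ℝ := fun o => o.elim b fun i => w i
  have hv₁ : Function.Injective v₁ := hwinj.comp Fin.val_injective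
  have hv₂ : Function.Injective v₂ := by
    rintro (_ | i) (_ | j) hij
    · rfl
    · exact absurd hij ((hwc j).trans_lt hcb).ne'
    · exact absurd hij ((hwc i).trans_lt hcb).ne
    · exact congrArg some (Fin.val_injective (hwinj hij))
  obtain ⟨P₁, hP₁, hPv₁⟩ := exists_natDegree_le_eval_eq hv₁ (m := m) (by simp) (f ∘ v₁)
  obtain ⟨P₂, hP₂, hPv₂⟩ := exists_natDegree_le_eval_eq hv₂ (m := m) (by simp) (f ∘ v₂)
  have hc₁ : P₁.eval c = f c := by simpa [v₁, hw0] using hPv₁ 0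
  have hc₂ : P₂.eval c = f c := by simpa [v₂, hw0] using hPv₂ (some ⟨0, hm⟩)
  obtain ⟨Q₁, hQ₁⟩ := exists_eval_sub_eq_mul hc₁
  obtain ⟨Q₂, hQ₂⟩ := exists_eval_sub_eq_mul hc₂
  have key (h : ℝ) (h0 : 0 < h) (hb : c + h < b) :
      Q₁.eval (c + h) ≤ (f (c + h) - f c) / h ∧ (f (c + h) - f c) / h ≤ Q₂.eval (c + h) := by
    have hyI : c + h ∈ Set.Icc a b := ⟨by linarith, hb.le⟩
    have hpos (i) : 0 < c + h - w i := by linarith [hwc i]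
    have n₁ := hf.mul_prod_nonneg hv₁ (by simp) (fun i => hwI i (by omega)) hP₁ hPv₁ hyI
      (fun i => (sub_pos.1 (hpos i)).ne')
    have n₂ := hf.mul_prod_nonneg hv₂ (by simp)
      (by rintro (_ | i)
          · exact ⟨(hac.trans hcb).le, le_rfl⟩
          · exact hwI i (by omega)) hP₂ hPv₂ hyI
      (by rintro (_ | i)
          · exact hb.ne
          · exact (sub_pos.1 (hpos i)).ne')
    have p₁ : 0 < ∏ i, (c + h - v₁ i) := Finset.prod_pos fun i _ => hpos i
    have p₂ : ∏ i, (c + h - v₂ i) < 0 := by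
      rw [Fintype.prod_option]
      exact mul_neg_of_neg_of_pos (sub_neg.2 hb) (Finset.prod_pos fun i _ => hpos i)
    have l₁ := nonneg_of_mul_nonneg_left n₁ p₁
    have l₂ : f (c + h) - P₂.eval (c + h) ≤ 0 := by
      by_contra! hh
      exact absurd n₂ (mul_neg_of_pos_of_neg hh p₂).not_ge
    have q₁ := hQ₁ (c + h)
    have q₂ := hQ₂ (c + h)
    rw [add_sub_cancel_left] at q₁ q₂
    constructor
    · rw [le_div_iff₀ h0]; linarith
    · rw [div_le_iff₀ h0]; linarith
  have t₁ := tendsto_eval_add_nhds_zero Q₁ c hU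
  have t₂ := tendsto_eval_add_nhds_zero Q₂ c hU
  have hmem : ∀ᶠ h in (U : Filter ℝ),
      (f (c + h) - f c) / h ∈ Set.Icc (Q₁.eval c - 1) (Q₂.eval c + 1) := by
    have e : ∀ᶠ h in (U : Filter ℝ), h ∈ Set.Ioo 0 (b - c) :=
      hU (Ioo_mem_nhdsGT (sub_pos.2 hcb))
    filter_upwards [e, t₁.eventually (lt_mem_nhds (sub_one_lt _)),
      t₂.eventually (gt_mem_nhds (lt_add_one _))] with h hh h₁ h₂
    obtain ⟨k₁, k₂⟩ := key h hh.1 (by linarith [hh.2])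
    exact ⟨h₁.le.trans k₁, k₂.trans h₂.le⟩
  obtain ⟨d, -, hd⟩ := isCompact_Icc.ultrafilter_le_nhds'
    (U.map fun h => (f (c + h) - f c) / h) hmem
  exact ⟨d, hd⟩

/-- Corollary 5: a `2n`-convex function on `[a, b]` is bounded above,
at `n` prescribed interior points together with the right endpoint `b`, by an
interpolating polynomial of degree at most `2n`. -/
theorem support_above_right_endpoint_nodes
    (n : ℕ) (hn : 1 ≤ n) (a b : ℝ) (f : ℝ → ℝ)
    (hf : NConvexOn (2 * n) (Set.Icc a b) f)
    (x : Fin (n + 1) → ℝ) (hx : StrictMono x)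
    (hxb : x ⟨n, by omega⟩ = b)
    (hxI : ∀ i : Fin (n + 1), i.val < n → x i ∈ Set.Ioo a b) :
    ∃ p : Polynomial ℝ, p.natDegree ≤ 2 * n ∧
      (∀ i, p.eval (x i) = f (x i)) ∧
      ∀ y ∈ Set.Icc a b, f y ≤ p.eval y := by
  classical
  have hlast : x (Fin.last n) = b := hxb
  have hcI (i : Fin n) : x i.castSucc ∈ Set.Ioo a b := hxI _ i.2
  obtain ⟨L, hLdeg, hL⟩ := exists_natDegree_le_eval_eq hx.injective (m := n) (by simp) (f ∘ x)
  set ω : ℝ[X] := Lagrange.nodal Finset.univ x with hω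
  have hωx (i) : ω.eval (x i) = 0 := Lagrange.eval_nodal_at_node (Finset.mem_univ i)
  have hωne (y : ℝ) (hy : ∀ i, y ≠ x i) : ω.eval y ≠ 0 :=
    Lagrange.eval_nodal_not_at_node fun i _ => hy i
  let r (h : ℝ) (d : Fin n → ℝ) : ℝ[X] :=
    Lagrange.interpolate Finset.univ (fun i => x i.castSucc + h) d
  have hinj (h : ℝ) : Function.Injective fun i : Fin n => x i.castSucc + h := fun i j hij =>
    Fin.castSucc_injective n (hx.injective (add_right_cancel hij))
  have hdeg (h : ℝ) (d : Fin n → ℝ) : (L + ω * r h d).natDegree ≤ 2 * n := by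
    have hr : (r h d).natDegree ≤ n - 1 := by
      refine natDegree_le_of_degree_le
        ((Lagrange.degree_interpolate_le d (hinj h).injOn).trans ?_)
      simp
    have hωd : ω.natDegree = n + 1 := by simp [hω]
    refine (natDegree_add_le _ _).trans (max_le (by omega) (natDegree_mul_le.trans ?_))
    omega
  have hnode (h : ℝ) (d : Fin n → ℝ) (i) : (L + ω * r h d).eval (x i) = f (x i) := by
    simp [hωx, hL]
  let g (h : ℝ) (i : Fin n) : ℝ :=
    (f (x i.castSucc + h) - L.eval (x i.castSucc + h)) / ω.eval (x i.castSucc + h)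
  obtain ⟨U, hU⟩ := Ultrafilter.exists_le (𝓝[>] (0 : ℝ))
  have hUpos : ∀ᶠ h in (U : Filter ℝ), 0 < h := hU self_mem_nhdsWithin
  have hg (i : Fin n) : ∃ d, Tendsto (fun h => g h i) U (𝓝 d) := by
    obtain ⟨d, hd⟩ := hf.exists_tendsto_slope (by omega) (hcI i) U hU
    obtain ⟨Q, hQ⟩ := exists_eval_sub_eq_mul (hL i.castSucc)
    set R := Lagrange.nodal (Finset.univ.erase i.castSucc) x with hR
    have hR0 : R.eval (x i.castSucc) ≠ 0 := Lagrange.eval_nodal_not_at_node fun j hj =>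
      hx.injective.ne (Finset.ne_of_mem_erase hj).symm
    refine ⟨_, ((hd.sub (tendsto_eval_add_nhds_zero Q (x i.castSucc) hU)).div
      (tendsto_eval_add_nhds_zero R _ hU) hR0).congr' ?_⟩
    filter_upwards [hUpos] with h h0
    have e : ω.eval (x i.castSucc + h) = h * R.eval (x i.castSucc + h) := by
      rw [hω, Lagrange.nodal_eq_mul_nodal_erase (Finset.mem_univ i.castSucc)]
      simp [hR]
    have q := hQ (x i.castSucc + h)
    rw [add_sub_cancel_left, Function.comp_apply, sub_eq_iff_eq_add] at q
    simp only [g, Pi.div_apply]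
    rw [e, q, ← div_div]
    congr 1
    field_simp
    ring
  choose d hd using hg
  refine ⟨L + ω * r 0 d, hdeg 0 d, hnode 0 d, fun y hy => ?_⟩
  by_cases hyx : ∃ i, y = x i
  · obtain ⟨i, rfl⟩ := hyx
    exact (hnode 0 d i).ge
  push Not at hyx
  have hlim : Tendsto (fun h => (L + ω * r h (g h)).eval y) U
      (𝓝 ((L + ω * r 0 d).eval y)) := by
    simp only [eval_add, eval_mul]
    refine tendsto_const_nhds.add (tendsto_const_nhds.mul ?_)
    simp only [r, Lagrange.interpolate_apply, eval_finsetSum, eval_mul, eval_C, Lagrange.basis,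
      eval_prod, Lagrange.basisDivisor, eval_sub, eval_X, add_sub_add_right_eq_sub]
    refine tendsto_finsetSum _ fun i _ => (hd i).mul (tendsto_finsetProd _ fun j _ => ?_)
    refine tendsto_const_nhds.mul (tendsto_const_nhds.sub (tendsto_const_nhds.add ?_))
    exact hU.trans nhdsWithin_le_nhds
  refine ge_of_tendsto hlim ?_
  have hyb : y < b := lt_of_le_of_ne hy.2 (hlast ▸ hyx _)
  have ev {φ : ℝ → ℝ} {s : Set ℝ} (hφ : Continuous φ) (hs : s ∈ 𝓝 (φ 0)) :
      ∀ᶠ h in (U : Filter ℝ), φ h ∈ s :=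
    (hU.trans nhdsWithin_le_nhds) (hφ.tendsto 0 hs)
  have e₁ : ∀ᶠ h in (U : Filter ℝ), ∀ i : Fin n, x i.castSucc + h < b := by
    refine eventually_all.2 fun i => ?_
    exact ev (φ := fun h => x i.castSucc + h) (s := Set.Iio b) (by fun_prop)
      (Iio_mem_nhds (by simpa using (hcI i).2))
  have e₂ : ∀ᶠ h in (U : Filter ℝ), ∀ (i : Fin n) (j : Fin (n + 1)), x i.castSucc + h ≠ x j := by
    refine eventually_all.2 fun i => eventually_all.2 fun j => ?_
    by_cases hij : i.castSucc = j
    · subst hij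
      filter_upwards [hUpos] with h h0
      linarith
    · exact ev (φ := fun h => x i.castSucc + h) (s := {x j}ᶜ) (by fun_prop)
        (isOpen_compl_singleton.mem_nhds (by simpa using hx.injective.ne hij))
  have e₃ : ∀ᶠ h in (U : Filter ℝ), ∀ i : Fin n,
      0 < (y - x i.castSucc) * (y - (x i.castSucc + h)) := by
    refine eventually_all.2 fun i => ?_
    refine ev (φ := fun h => (y - x i.castSucc) * (y - (x i.castSucc + h))) (s := Set.Ioi 0)
      (by fun_prop) (Ioi_mem_nhds ?_)
    rw [add_zero]
    exact mul_self_pos.2 (sub_ne_zero.2 (hyx _))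
  filter_upwards [hUpos, e₁, e₂, e₃] with h h0 h₁ h₂ h₃
  let v : Fin (n + 1) ⊕ Fin n → ℝ := Sum.elim x fun i => x i.castSucc + h
  have hv : Function.Injective v :=
    hx.injective.sumElim (hinj h) fun j i => (h₂ i j).symm
  have hvI : ∀ i, v i ∈ Set.Icc a b := by
    rintro (i | i)
    · refine Fin.lastCases ?_ (fun i => ?_) i
      · simpa [v, hlast] using hy.1.trans hy.2
      · exact Set.Ioo_subset_Icc_self (hcI i)
    · exact ⟨by linarith [(hcI i).1, show v (.inr i) = x i.castSucc + h from rfl], (h₁ i).le⟩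
  have hPv : ∀ i, (L + ω * r h (g h)).eval (v i) = f (v i) := by
    rintro (i | i)
    · exact hnode h _ i
    · have e : (r h (g h)).eval (x i.castSucc + h) = g h i :=
        Lagrange.eval_interpolate_at_node (v := fun i : Fin n => x i.castSucc + h) (g h)
          (hinj h).injOn (Finset.mem_univ i)
      have := hωne _ (h₂ i)
      simp only [v, Sum.elim_inr, eval_add, eval_mul, e, g]
      field_simp
      ring
  have hyv : ∀ i, y ≠ v i := by
    rintro (i | i)
    · exact hyx i
    · exact sub_ne_zero.1 (right_ne_zero_of_mul (h₃ i).ne')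
  have key := hf.mul_prod_nonneg hv (by simp; omega) hvI (hdeg h _) hPv hy hyv
  have hneg : ∏ i, (y - v i) < 0 := by
    have : ∏ i, (y - v i) =
        (∏ i : Fin n, (y - x i.castSucc) * (y - (x i.castSucc + h))) * (y - b) := by
      rw [Fintype.prod_sum_type, Finset.prod_mul_distrib]
      simp only [v, Sum.elim_inl, Sum.elim_inr]
      rw [Fin.prod_univ_castSucc, hlast]
      ring
    rw [this]
    exact mul_neg_of_pos_of_neg (Finset.prod_pos fun i _ => h₃ i) (sub_neg.2 hyb)
  by_contra! hh
  exact absurd key (mul_neg_of_pos_of_neg (sub_pos.2 hh) hneg).not_ge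
end

section
/- Let n ∈ ℕ, n ≥ 1, let w : [a, b] → [0, ∞) be an integrable weight function, let x₁ < … < x_n be points of the open interval (a, b), and let w₀, w₁, …, w_n ∈ ℝ be such that w₀ p(a) + Σ_{i=1}^n wᵢ p(xᵢ) = ∫ₐᵇ p(x) w(x) dx for every polynomial p ∈ Π_{2n} (a left Radau-type quadrature rule). Then for every 2n-convex function f : [a, b] → ℝ (any such f is Riemann integrable on [a, b]) one has w₀ f(a) + Σ_{i=1}^n wᵢ f(xᵢ) ≤ ∫ₐᵇ f(x) w(x) dx. -/
/-- The divided difference of `f` over a finite set of nodes, in its symmetric form. -/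
noncomputable def finsetDivDiff (f : ℝ → ℝ) (s : Finset ℝ) : ℝ :=
  ∑ x ∈ s, Lagrange.nodalWeight s id x * f x

theorem finsetDivDiff_insert (f : ℝ → ℝ) {s : Finset ℝ} {x : ℝ} (hx : x ∉ s) :
    finsetDivDiff f (insert x s) =
      (∏ y ∈ s, (x - y)⁻¹) * f x +
        ∑ z ∈ s, (z - x)⁻¹ * (Lagrange.nodalWeight s id z * f z) := by
  unfold finsetDivDiff
  rw [Finset.sum_insert hx]
  congr 1
  · simp [Lagrange.nodalWeight, Finset.erase_insert hx]
  · refine Finset.sum_congr rfl fun z hz => ?_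
    have hzx : x ≠ z := fun h => hx (h ▸ hz)
    rw [Lagrange.nodalWeight, Lagrange.nodalWeight, Finset.erase_insert_of_ne hzx,
      Finset.prod_insert (fun h => hx (Finset.mem_of_mem_erase h))]
    simp only [id_eq]
    ring

theorem finsetDivDiff_insert_sub_insert (f : ℝ → ℝ) {s : Finset ℝ} {x y : ℝ}
    (hx : x ∉ s) (hy : y ∉ s) (hxy : x ≠ y) :
    finsetDivDiff f (insert x s) - finsetDivDiff f (insert y s) =
      (x - y) * finsetDivDiff f (insert x (insert y s)) := by
  have hxy' : x - y ≠ 0 := sub_ne_zero.2 hxy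
  have hyx' : y - x ≠ 0 := sub_ne_zero.2 hxy.symm
  have hxs : x ∉ insert y s := by simp [hxy, hx]
  have hweight : ∀ z ∈ s, Lagrange.nodalWeight (insert y s) id z =
      (z - y)⁻¹ * Lagrange.nodalWeight s id z := by
    intro z hz
    have hzy : y ≠ z := fun h => hy (h ▸ hz)
    rw [Lagrange.nodalWeight, Lagrange.nodalWeight, Finset.erase_insert_of_ne hzy,
      Finset.prod_insert (fun h => hy (Finset.mem_of_mem_erase h))]
    simp only [id_eq]
  have hweight_y : Lagrange.nodalWeight (insert y s) id y = ∏ z ∈ s, (y - z)⁻¹ := by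
    simp [Lagrange.nodalWeight, Finset.erase_insert hy]
  rw [finsetDivDiff_insert f hx, finsetDivDiff_insert f hy, finsetDivDiff_insert f hxs,
    Finset.prod_insert hy, Finset.sum_insert hy, hweight_y]
  have hsum : ∑ z ∈ s, (z - x)⁻¹ * (Lagrange.nodalWeight s id z * f z) -
      ∑ z ∈ s, (z - y)⁻¹ * (Lagrange.nodalWeight s id z * f z) =
      (x - y) * ∑ z ∈ s, (z - x)⁻¹ * (Lagrange.nodalWeight (insert y s) id z * f z) := by
    rw [← Finset.sum_sub_distrib, Finset.mul_sum]
    refine Finset.sum_congr rfl fun z hz => ?_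
    have hzx : z - x ≠ 0 := sub_ne_zero.2 fun h => hx (h ▸ hz)
    have hzy : z - y ≠ 0 := sub_ne_zero.2 fun h => hy (h ▸ hz)
    rw [hweight z hz]
    field_simp
    ring
  have hinv : (x - y) * (y - x)⁻¹ = -1 := by
    rw [← neg_sub y x, neg_mul, mul_inv_cancel₀ hyx']
  linear_combination hsum - (∏ z ∈ s, (y - z)⁻¹) * f y * hinv -
    (∏ z ∈ s, (x - z)⁻¹) * f x * mul_inv_cancel₀ hxy'

theorem divDiff_eq_finsetDivDiff (f : ℝ → ℝ) (l : List ℝ) (hl : l.Nodup) :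
    divDiff f l = finsetDivDiff f l.toFinset := by
  induction l using divDiff.induct with
  | case1 => simp [divDiff, finsetDivDiff]
  | case2 x => simp [divDiff, finsetDivDiff, Lagrange.nodalWeight]
  | case3 x y l ih₁ ih₂ =>
    have hsplit := List.dropLast_append_getLast (List.cons_ne_nil y l)
    rw [divDiff]
    generalize (y :: l).getLast (List.cons_ne_nil y l) = z at *
    generalize (y :: l).dropLast = m at *
    rw [← hsplit] at hl ih₁ ⊢
    have hl' : x ∉ m ∧ x ≠ z ∧ m.Nodup ∧ z ∉ m := by
      simp only [List.nodup_cons, List.nodup_append, List.mem_append, List.mem_singleton] at hl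
      grind
    obtain ⟨hxm, hxz, hm, hzm⟩ := hl'
    rw [ih₁ (List.nodup_cons.1 hl).2, ih₂ (List.nodup_cons.2 ⟨hxm, hm⟩)]
    have hset : (m ++ [z]).toFinset = insert z m.toFinset := by
      ext; simp
    rw [List.toFinset_cons, List.toFinset_cons, hset, Finset.insert_comm,
      finsetDivDiff_insert_sub_insert f (by simpa using hzm) (by simpa using hxm) hxz.symm,
      mul_div_cancel_left₀ _ (sub_ne_zero.2 hxz.symm)]

theorem NConvexOn.finsetDivDiff_nonneg {n : ℕ} {I : Set ℝ} {f : ℝ → ℝ} (hf : NConvexOn n I f)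
    {s : Finset ℝ} (hs : s.card = n + 2) (hsI : ↑s ⊆ I) : 0 ≤ finsetDivDiff f s := by
  have h := hf s.toList (by simpa using hs) s.nodup_toList fun x hx => hsI (by simpa using hx)
  rwa [divDiff_eq_finsetDivDiff f _ s.nodup_toList, Finset.toList_toFinset] at h

theorem sub_eval_interpolate_eq (f : ℝ → ℝ) {s : Finset ℝ} {t : ℝ} (ht : t ∉ s) :
    f t - (Lagrange.interpolate s id f).eval t =
      finsetDivDiff f (insert t s) * ∏ y ∈ s, (t - y) := by
  have hne : ∀ y ∈ s, t ≠ id y := fun y hy h => ht (by rw [h]; exact hy)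
  have hprod : ∏ y ∈ s, (t - y) ≠ 0 :=
    Finset.prod_ne_zero_iff.2 fun y hy => sub_ne_zero.2 (hne y hy)
  rw [Lagrange.eval_interpolate_not_at_node f hne, finsetDivDiff_insert f ht, Lagrange.eval_nodal,
    Finset.prod_inv_distrib]
  have hsum : ∑ z ∈ s, (z - t)⁻¹ * (Lagrange.nodalWeight s id z * f z) =
      -∑ z ∈ s, Lagrange.nodalWeight s id z * (t - id z)⁻¹ * f z := by
    rw [← Finset.sum_neg_distrib]
    refine Finset.sum_congr rfl fun z _ => ?_
    rw [← neg_sub t z, inv_neg, id_eq]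
    ring
  rw [hsum]
  simp only [id_eq]
  field_simp
  ring

theorem NConvexOn.finsetDivDiff_insert_le {n : ℕ} {I : Set ℝ} {f : ℝ → ℝ}
    (hf : NConvexOn n I f) {s : Finset ℝ} (hs : s.card = n) (hsI : ↑s ⊆ I) {x y : ℝ}
    (hx : x ∈ I) (hy : y ∈ I) (hxs : x ∉ s) (hys : y ∉ s) (hxy : x ≤ y) :
    finsetDivDiff f (insert x s) ≤ finsetDivDiff f (insert y s) := by
  rcases hxy.eq_or_lt with rfl | hlt
  · rfl
  have hy' : y ∉ insert x s := by simp [hlt.ne', hys]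
  have h := hf.finsetDivDiff_nonneg (s := insert y (insert x s))
    (by rw [Finset.card_insert_of_notMem hy', Finset.card_insert_of_notMem hxs, hs])
    (by simp [Set.insert_subset_iff, hx, hy, hsI])
  rw [← sub_nonneg, finsetDivDiff_insert_sub_insert f hys hxs hlt.ne']
  exact mul_nonneg (sub_nonneg.2 hxy) h

theorem NConvexOn.finsetDivDiff_union_le {n : ℕ} {I : Set ℝ} {f : ℝ → ℝ}
    (hf : NConvexOn n I f) {s t : Finset ℝ} (hst : s.card = t.card)
    (hlt : ∀ x ∈ s, ∀ y ∈ t, x < y) {u : Finset ℝ} (hsu : Disjoint s u) (htu : Disjoint t u)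
    (hcard : s.card + u.card = n + 1) (hsI : ↑s ⊆ I) (htI : ↑t ⊆ I) (huI : ↑u ⊆ I) :
    finsetDivDiff f (s ∪ u) ≤ finsetDivDiff f (t ∪ u) := by
  induction s using Finset.induction_on generalizing t u with
  | empty => rw [Finset.card_empty, eq_comm, Finset.card_eq_zero] at hst; simp [hst]
  | insert x s hxs ih =>
    rw [Finset.card_insert_of_notMem hxs] at hst hcard
    obtain ⟨y, t, hyt, rfl, htc⟩ := Finset.card_eq_succ.1 hst.symm
    simp only [Finset.disjoint_insert_left] at hsu htu
    simp only [Finset.coe_insert, Set.insert_subset_iff] at hsI htI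
    simp only [Finset.mem_insert, forall_eq_or_imp] at hlt
    have hys : y ∉ s := fun h => lt_irrefl y (hlt.2 y h).1
    have hxu : x ∉ s ∪ u := by simp [hxs, hsu.1]
    have hyu : y ∉ s ∪ u := by simp [hys, htu.1]
    have h₁ : finsetDivDiff f (insert x (s ∪ u)) ≤ finsetDivDiff f (insert y (s ∪ u)) := by
      refine hf.finsetDivDiff_insert_le ?_ (by simp [hsI.2, huI]) hsI.1 htI.1 hxu hyu hlt.1.1.le
      rw [Finset.card_union_of_disjoint hsu.2]
      omega
    have h₂ : finsetDivDiff f (s ∪ insert y u) ≤ finsetDivDiff f (t ∪ insert y u) := by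
      refine ih htc.symm (fun a ha b hb => (hlt.2 a ha).2 b hb) ?_ ?_ ?_ hsI.2 htI.2 ?_
      · simp [hys, hsu.2]
      · simp [hyt, htu.2]
      · rw [Finset.card_insert_of_notMem htu.1]; omega
      · simp [Set.insert_subset_iff, htI.1, huI]
    rw [Finset.insert_union, Finset.insert_union]
    rw [Finset.union_insert, Finset.union_insert] at h₂
    exact h₁.trans h₂

theorem NConvexOn.intervalIntegrable_mul {n : ℕ} {a b : ℝ} (hab : a < b) {f w : ℝ → ℝ}
    (hf : NConvexOn n (Set.Icc a b) f) (hw : IntervalIntegrable w MeasureTheory.volume a b) :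
    IntervalIntegrable (fun t => f t * w t) MeasureTheory.volume a b := by
  obtain ⟨s, hsI, hs⟩ := (Set.Ioo_infinite hab).exists_subset_card_eq n
  have hsI' : (s : Set ℝ) ⊆ Set.Icc a b := hsI.trans Set.Ioo_subset_Icc_self
  have has : a ∉ s := fun h => lt_irrefl a (hsI h).1
  have hbs : b ∉ s := fun h => lt_irrefl b (hsI h).2
  have hmono : MonotoneOn (fun t => finsetDivDiff f (insert t s)) (Set.Icc a b \ s) :=
    fun u hu v hv huv => hf.finsetDivDiff_insert_le hs hsI' hu.1 hv.1 hu.2 hv.2 huv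
  have hmeas : MeasurableSet (Set.Icc a b \ (s : Set ℝ)) :=
    measurableSet_Icc.diff s.measurableSet
  rw [intervalIntegrable_iff_integrableOn_Icc_of_le hab.le] at hw ⊢
  have hws : MeasureTheory.IntegrableOn w (Set.Icc a b \ s) := hw.mono_set Set.sdiff_subset
  have hp : MeasureTheory.IntegrableOn
      (fun t => (Lagrange.interpolate s id f).eval t * w t) (Set.Icc a b \ s) :=
    (hw.continuousOn_mul (Polynomial.continuous _).continuousOn isCompact_Icc).mono_set
      Set.sdiff_subset
  have hr : MeasureTheory.IntegrableOn (fun t => (∏ y ∈ s, (t - y)) * w t) (Set.Icc a b \ s) :=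
    (hw.continuousOn_mul (by fun_prop) isCompact_Icc).mono_set Set.sdiff_subset
  have hg : MeasureTheory.IntegrableOn
      (fun t => finsetDivDiff f (insert t s) * ((∏ y ∈ s, (t - y)) * w t))
      (Set.Icc a b \ s) := by
    refine MeasureTheory.Integrable.bdd_mul
      (c := max |finsetDivDiff f (insert a s)| |finsetDivDiff f (insert b s)|) hr
      (aemeasurable_restrict_of_monotoneOn hmeas hmono).aestronglyMeasurable ?_
    refine (MeasureTheory.ae_restrict_iff' hmeas).2 (Filter.Eventually.of_forall fun t ht => ?_)
    rw [Real.norm_eq_abs]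
    exact abs_le_max_abs_abs (hmono ⟨⟨le_rfl, hab.le⟩, has⟩ ht ht.1.1)
      (hmono ht ⟨⟨hab.le, le_rfl⟩, hbs⟩ ht.1.2)
  have hdiff : MeasureTheory.IntegrableOn (fun t => f t * w t) (Set.Icc a b \ s) := by
    refine (hp.add hg).congr_fun (fun t ht => ?_) hmeas
    have h := sub_eval_interpolate_eq f (s := s) (t := t) (fun h => ht.2 h)
    simp only [Pi.add_apply]
    linear_combination (-w t) * h
  have hnull : MeasureTheory.IntegrableOn (fun t => f t * w t) (s : Set ℝ) :=
    MeasureTheory.IntegrableOn.of_measure_zero (s.measure_zero _)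
  exact (hdiff.union hnull).mono_set fun t ht => by by_cases h : t ∈ s <;> simp [h, ht.1, ht.2]

open Filter Topology in
theorem eventually_add_lt {n : ℕ} {x : Fin n → ℝ} (hx : StrictMono x) {c : ℝ}
    (hc : ∀ i, x i < c) :
    ∀ᶠ h in 𝓝[>] (0 : ℝ), 0 < h ∧ (∀ i j, i < j → x i + h < x j) ∧ ∀ i, x i + h < c := by
  have key : ∀ u v : ℝ, u < v → ∀ᶠ h in 𝓝[>] (0 : ℝ), u + h < v := by
    intro u v huv
    have : Tendsto (fun h : ℝ => u + h) (𝓝[>] 0) (𝓝 u) := by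
      have h : Continuous fun h : ℝ => u + h := by fun_prop
      simpa using (h.tendsto 0).mono_left nhdsWithin_le_nhds
    exact this.eventually_lt_const huv
  refine eventually_mem_nhdsWithin.and (.and ?_ ?_)
  · refine eventually_all.2 fun i => eventually_all.2 fun j => ?_
    by_cases hij : i < j
    · exact (key _ _ (hx hij)).mono fun h hh _ => hh
    · exact Eventually.of_forall fun h hh => absurd hh hij
  · exact eventually_all.2 fun i => key _ _ (hc i)

/-- The nodes of a left Radau rule, each interior node `x i` being doubled to `x i`, `x i + h`. -/
noncomputable def doubledNodes {n : ℕ} (a : ℝ) (x : Fin n → ℝ) (h : ℝ) : Finset ℝ :=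
  insert a (Finset.univ.image x ∪ Finset.univ.image fun i => x i + h)

section doubledNodes

variable {n : ℕ} {a h : ℝ} {x : Fin n → ℝ}

theorem mem_doubledNodes {t : ℝ} :
    t ∈ doubledNodes a x h ↔ t = a ∨ (∃ i, x i = t) ∨ ∃ i, x i + h = t := by
  simp [doubledNodes]

theorem add_ne_of_forall_lt (h0 : 0 < h) (hx : StrictMono x)
    (hsep : ∀ i j, i < j → x i + h < x j) (i j : Fin n) : x i + h ≠ x j := by
  rcases lt_or_ge i j with hij | hij
  · exact (hsep i j hij).ne
  · have := hx.monotone hij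
    linarith +splitNe

theorem prod_doubledNodes (h0 : 0 < h) (hx : StrictMono x)
    (hsep : ∀ i j, i < j → x i + h < x j) (ha : ∀ i, a < x i) {M : Type*} [CommMonoid M]
    (F : ℝ → M) :
    ∏ y ∈ doubledNodes a x h, F y = F a * ∏ i, F (x i) * F (x i + h) := by
  have hne := add_ne_of_forall_lt h0 hx hsep
  rw [doubledNodes, Finset.prod_insert, Finset.prod_union, Finset.prod_image, Finset.prod_image,
    Finset.prod_mul_distrib]
  · exact fun i _ j _ hij => hx.injective (by simpa using hij)
  · exact fun i _ j _ hij => hx.injective hij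
  · simp only [Finset.disjoint_left, Finset.mem_image, Finset.mem_univ, true_and]
    rintro _ ⟨i, rfl⟩ ⟨j, hj⟩
    exact hne j i hj
  · simp only [Finset.mem_union, Finset.mem_image, Finset.mem_univ, true_and]
    rintro (⟨i, hi⟩ | ⟨i, hi⟩) <;> linarith [ha i]

theorem card_doubledNodes (h0 : 0 < h) (hx : StrictMono x)
    (hsep : ∀ i j, i < j → x i + h < x j) (ha : ∀ i, a < x i) :
    (doubledNodes a x h).card = 2 * n + 1 := by
  have := prod_doubledNodes h0 hx hsep ha (fun _ => Multiplicative.ofAdd (1 : ℕ))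
  rw [Finset.prod_const, Finset.prod_const] at this
  have h' := congrArg Multiplicative.toAdd this
  simp at h'
  omega

end doubledNodes

theorem NConvexOn.sub_mul_finsetDivDiff_le {n : ℕ} {a b c d u v t : ℝ} {f : ℝ → ℝ}
    (hf : NConvexOn n (Set.Icc a b) f) (had : a < d) (hdu : d ≤ u) (hut : u < t) (htv : t < v)
    (hvc : v < c) (hcb : c < b) {s r N : Finset ℝ}
    (hs : ↑s ⊆ Set.Ioo c b) (hs_card : s.card = n + 1)
    (hr : ↑r ⊆ Set.Ioo a d) (hr_card : r.card = n)
    (hN : ∀ y ∈ N, d ≤ y ∧ y < c) (hN_card : N.card + 2 = n)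
    (huN : u ∉ N) (hvN : v ∉ N) (htN : t ∉ N) :
    (v - u) * finsetDivDiff f (insert t (insert u (insert v (insert a N)))) ≤
      finsetDivDiff f s - finsetDivDiff f (insert a r) := by
  have hau : a < u := had.trans_le hdu
  have huv : u < v := hut.trans htv
  have hsI : (s : Set ℝ) ⊆ Set.Icc a b := fun y hy =>
    ⟨by linarith [(hs hy).1], (hs hy).2.le⟩
  have hrI : (r : Set ℝ) ⊆ Set.Icc a b := fun y hy =>
    ⟨(hr hy).1.le, by linarith [(hr hy).2]⟩
  have hNI : (N : Set ℝ) ⊆ Set.Icc a b := fun y hy =>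
    ⟨by linarith [(hN y hy).1], by linarith [(hN y hy).2]⟩
  have haI : a ∈ Set.Icc a b := ⟨le_rfl, by linarith⟩
  have huI : u ∈ Set.Icc a b := ⟨by linarith, by linarith⟩
  have hvI : v ∈ Set.Icc a b := ⟨by linarith, by linarith⟩
  have htI : t ∈ Set.Icc a b := ⟨by linarith, by linarith⟩
  have har : a ∉ r := fun h => lt_irrefl a (hr h).1
  have haN : a ∉ N := fun h => by linarith [(hN a h).1]
  have htN' : t ∉ insert a N := by simp [htN, (hau.trans hut).ne']
  have hutN : u ∉ insert t N := by simp [huN, hut.ne]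
  have hutN' : u ∉ insert t (insert a N) := by simp [huN, hut.ne, hau.ne']
  have hvtN : v ∉ insert t (insert a N) := by simp [hvN, htv.ne', (hau.trans huv).ne']
  have hrec := finsetDivDiff_insert_sub_insert f hvtN hutN' huv.ne'
  have hset : insert v (insert u (insert t (insert a N))) =
      insert t (insert u (insert v (insert a N))) := by
    rw [Finset.insert_comm u t, Finset.insert_comm v t, Finset.insert_comm v u]
  rw [hset] at hrec
  have hU : finsetDivDiff f (insert v (insert t (insert a N))) ≤ finsetDivDiff f s := by
    have hcard : (insert v (insert t (insert a N))).card = n + 1 := by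
      rw [Finset.card_insert_of_notMem hvtN, Finset.card_insert_of_notMem htN',
        Finset.card_insert_of_notMem haN]
      omega
    have := hf.finsetDivDiff_union_le (s := insert v (insert t (insert a N))) (t := s) (u := ∅)
      (by rw [hcard, hs_card]) ?_ (by simp) (by simp) (by rw [hcard]; simp)
      (by
        simp only [Finset.coe_insert, Set.insert_subset_iff]
        exact ⟨hvI, htI, haI, hNI⟩) hsI (by simp)
    · simpa using this
    · intro y hy z hz
      have hz' := (hs hz).1
      simp only [Finset.mem_insert] at hy
      rcases hy with rfl | rfl | rfl | hy
      · linarith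
      · linarith
      · linarith
      · linarith [(hN y hy).2]
  have hL : finsetDivDiff f (insert a r) ≤ finsetDivDiff f (insert u (insert t (insert a N))) := by
    have := hf.finsetDivDiff_union_le (s := r) (t := insert u (insert t N)) (u := {a})
      (by
        rw [Finset.card_insert_of_notMem hutN, Finset.card_insert_of_notMem htN, hr_card]
        omega) ?_ (by simpa using har) (by simp [haN, hau.ne, (hau.trans hut).ne])
      (by rw [hr_card]; simp) hrI
      (by
        simp only [Finset.coe_insert, Set.insert_subset_iff]
        exact ⟨huI, htI, hNI⟩) (by simpa using haI)
    · rwa [Finset.union_singleton, Finset.union_singleton, Finset.insert_comm a u,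
        Finset.insert_comm a t] at this
    · intro y hy z hz
      have hy' := (hr hy).2
      simp only [Finset.mem_insert] at hz
      rcases hz with rfl | rfl | hz
      · linarith
      · linarith
      · linarith [(hN z hz).1]
  linarith

theorem NConvexOn.neg_mul_le_sub_eval_interpolate {n : ℕ} {a b c d h : ℝ} {x : Fin n → ℝ}
    {f : ℝ → ℝ} (hf : NConvexOn (2 * n) (Set.Icc a b) f) (hx : StrictMono x)
    (had : a < d) (hdx : ∀ i, d ≤ x i) (hdc : d ≤ c) (hcb : c < b) (h0 : 0 < h)
    (hsep : ∀ i j, i < j → x i + h < x j) (hxc : ∀ i, x i + h < c)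
    {s r : Finset ℝ} (hs : ↑s ⊆ Set.Ioo c b) (hs_card : s.card = 2 * n + 1)
    (hr : ↑r ⊆ Set.Ioo a d) (hr_card : r.card = 2 * n) {t : ℝ} (ht : t ∈ Set.Icc a b) :
    -(h * ((b - a) ^ (2 * n - 1) *
      (finsetDivDiff f s - finsetDivDiff f (insert a r)))) ≤
      f t - (Lagrange.interpolate (doubledNodes a x h) id f).eval t := by
  have hax : ∀ i, a < x i := fun i => had.trans_le (hdx i)
  have hcard := card_doubledNodes h0 hx hsep hax
  have hprod := prod_doubledNodes h0 hx hsep hax (fun y => t - y)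
  have hmem : ∀ y ∈ doubledNodes a x h, y = a ∨ d ≤ y ∧ y < c := by
    intro y hy
    rcases mem_doubledNodes.1 hy with rfl | ⟨i, rfl⟩ | ⟨i, rfl⟩
    · exact .inl rfl
    · exact .inr ⟨hdx i, by linarith [hxc i]⟩
    · exact .inr ⟨by linarith [hdx i], hxc i⟩
  have hI : ∀ y ∈ doubledNodes a x h, y ∈ Set.Icc a b := by
    intro y hy
    rcases hmem y hy with rfl | hy
    · exact ⟨le_rfl, ht.1.trans ht.2⟩
    · exact ⟨by linarith, by linarith⟩
  have hab : a ≤ b := ht.1.trans ht.2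
  have har : a ∉ r := fun h' => lt_irrefl a (hr h').1
  have hsI : (s : Set ℝ) ⊆ Set.Icc a b := by
    intro y hy
    have := hs hy
    exact ⟨by linarith [this.1], this.2.le⟩
  have hrI : (r : Set ℝ) ⊆ Set.Icc a b := by
    intro y hy
    have := hr hy
    exact ⟨this.1.le, by linarith [this.2]⟩
  have haI : a ∈ Set.Icc a b := ⟨le_rfl, hab⟩
  have hLU : finsetDivDiff f (insert a r) ≤ finsetDivDiff f s := by
    have := hf.finsetDivDiff_union_le (s := insert a r) (t := s) (u := ∅)
      (by rw [Finset.card_insert_of_notMem har, hr_card, hs_card]) ?_ (by simp) (by simp)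
      (by rw [Finset.card_insert_of_notMem har, hr_card]; simp)
      (by simp [Set.insert_subset_iff, haI, hrI]) hsI (by simp)
    · simpa using this
    · intro y hy z hz
      have hz' := (hs hz).1
      rcases Finset.mem_insert.1 hy with rfl | hy
      · linarith
      · linarith [(hr hy).2]
  have hK : 0 ≤ (b - a) ^ (2 * n - 1) := pow_nonneg (sub_nonneg.2 hab) _
  have hbound : -(h * ((b - a) ^ (2 * n - 1) *
      (finsetDivDiff f s - finsetDivDiff f (insert a r)))) ≤ 0 :=
    neg_nonpos.2 (mul_nonneg h0.le (mul_nonneg hK (sub_nonneg.2 hLU)))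
  by_cases htS : t ∈ doubledNodes a x h
  · have := Lagrange.eval_interpolate_at_node (v := id) f (Function.injective_id.injOn) htS
    rw [id_eq] at this
    rwa [this, sub_self]
  rw [sub_eval_interpolate_eq f htS]
  have hD : 0 ≤ finsetDivDiff f (insert t (doubledNodes a x h)) := by
    refine hf.finsetDivDiff_nonneg (by rw [Finset.card_insert_of_notMem htS, hcard]) ?_
    rw [Finset.coe_insert, Set.insert_subset_iff]
    exact ⟨ht, hI⟩
  by_cases hpos : ∀ i, 0 ≤ (t - x i) * (t - (x i + h))
  · refine hbound.trans (mul_nonneg hD ?_)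
    rw [hprod]
    exact mul_nonneg (sub_nonneg.2 ht.1) (Finset.prod_nonneg fun i _ => hpos i)
  push Not at hpos
  obtain ⟨i, hi⟩ := hpos
  have hut : x i < t := by
    by_contra! hle
    exact absurd hi (not_lt.2 (mul_nonneg_of_nonpos_of_nonpos (by linarith) (by linarith)))
  have htv : t < x i + h := by
    by_contra! hle
    exact absurd hi (not_lt.2 (mul_nonneg (by linarith) (by linarith)))
  have huS : x i ∈ doubledNodes a x h := mem_doubledNodes.2 (.inr (.inl ⟨i, rfl⟩))
  have hvS : x i + h ∈ doubledNodes a x h := mem_doubledNodes.2 (.inr (.inr ⟨i, rfl⟩))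
  have haS : a ∈ doubledNodes a x h := mem_doubledNodes.2 (.inl rfl)
  have hau := hax i
  have hdu := hdx i
  have hvc := hxc i
  generalize x i = u at *
  generalize hv : u + h = v at *
  generalize doubledNodes a x h = S at *
  obtain ⟨N, huN, rfl⟩ : ∃ N, u ∉ N ∧ insert u N = S :=
    ⟨S.erase u, Finset.notMem_erase _ _, Finset.insert_erase huS⟩
  have huv : u < v := by linarith
  have hvN' : v ∈ N := (Finset.mem_insert.1 hvS).resolve_left huv.ne'
  obtain ⟨N, hvN, rfl⟩ : ∃ N', v ∉ N' ∧ insert v N' = N :=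
    ⟨N.erase v, Finset.notMem_erase _ _, Finset.insert_erase hvN'⟩
  have haN' : a ∈ N := by
    simp only [Finset.mem_insert] at haS
    rcases haS with h' | h' | h'
    · linarith
    · linarith
    · exact h'
  obtain ⟨N, haN, rfl⟩ : ∃ N', a ∉ N' ∧ insert a N' = N :=
    ⟨N.erase a, Finset.notMem_erase _ _, Finset.insert_erase haN'⟩
  have hNmem : ∀ y ∈ N, d ≤ y ∧ y < c := fun y hy =>
    (hmem y (by simp [hy])).resolve_left fun h' => haN (h' ▸ hy)
  rw [Finset.card_insert_of_notMem huN, Finset.card_insert_of_notMem hvN,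
    Finset.card_insert_of_notMem haN] at hcard
  have htN : t ∉ insert a N := fun h' => htS (by simp only [Finset.mem_insert] at h' ⊢; tauto)
  have hgap := hf.sub_mul_finsetDivDiff_le had hdu hut htv hvc hcb hs hs_card hr hr_card hNmem
    (by omega) (fun h' => huN (by simp [h'])) (fun h' => hvN (by simp [h']))
    (fun h' => htN (by simp [h']))
  have hP : |∏ y ∈ insert a N, (t - y)| ≤ (b - a) ^ (2 * n - 1) := by
    rw [Finset.abs_prod]
    have hcard_sub : (insert a N).card = 2 * n - 1 := by
      rw [Finset.card_insert_of_notMem haN]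
      omega
    rw [← hcard_sub, ← Finset.prod_const]
    refine Finset.prod_le_prod (fun _ _ => abs_nonneg _) fun y hy => ?_
    have hy' := hI y (by simp only [Finset.mem_insert] at hy ⊢; tauto)
    exact abs_le.2 ⟨by linarith [hy'.2, ht.1], by linarith [hy'.1, ht.2]⟩
  rw [Finset.prod_insert huN, Finset.prod_insert hvN]
  set D := finsetDivDiff f (insert t (insert u (insert v (insert a N))))
  set P := ∏ y ∈ insert a N, (t - y)
  have hhD : h * D ≤ finsetDivDiff f s - finsetDivDiff f (insert a r) := by
    rwa [← hv, add_sub_cancel_left] at hgap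
  have h₁ : (t - u) * (v - t) ≤ h * h :=
    mul_le_mul (by linarith) (by linarith) (by linarith) h0.le
  have h₂ : (t - u) * (v - t) * P ≤ h * h * (b - a) ^ (2 * n - 1) :=
    (mul_le_mul_of_nonneg_left ((le_abs_self P).trans hP)
      (mul_nonneg (by linarith) (by linarith))).trans (mul_le_mul_of_nonneg_right h₁ hK)
  calc _ ≤ -(h * ((b - a) ^ (2 * n - 1) * (h * D))) := by gcongr
    _ = -(D * (h * h * (b - a) ^ (2 * n - 1))) := by ring
    _ ≤ -(D * ((t - u) * (v - t) * P)) := by gcongr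
    _ = _ := by ring

open MeasureTheory in
/-- Proposition 2, first inequality (left Radau-type quadratures): a quadrature rule
using the left endpoint and `n` nodes in `(a, b)` which is exact on `Π_{2n}`
underestimates the weighted integral of every `2n`-convex function. -/
theorem radau_left_quadrature_le_integral
    (n : ℕ) (hn : 1 ≤ n) (a b : ℝ)
    (w : ℝ → ℝ) (hw_int : IntervalIntegrable w volume a b)
    (hw_nonneg : ∀ x ∈ Set.Icc a b, 0 ≤ w x)
    (x : Fin n → ℝ) (hx : StrictMono x) (hxI : ∀ i, x i ∈ Set.Ioo a b)
    (w₀ : ℝ) (wt : Fin n → ℝ)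
    (hexact : ∀ p : Polynomial ℝ, p.natDegree ≤ 2 * n →
      w₀ * p.eval a + ∑ i, wt i * p.eval (x i) = ∫ t in a..b, p.eval t * w t)
    (f : ℝ → ℝ) (hf : NConvexOn (2 * n) (Set.Icc a b) f) :
    w₀ * f a + ∑ i, wt i * f (x i) ≤ ∫ t in a..b, f t * w t := by
  have hn0 : 0 < n := hn
  let i₀ : Fin n := ⟨0, hn0⟩
  let i₁ : Fin n := ⟨n - 1, by omega⟩
  have hi₀ : ∀ i, x i₀ ≤ x i := fun i => hx.monotone (Fin.mk_le_of_le_val (Nat.zero_le _))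
  have hi₁ : ∀ i, x i ≤ x i₁ := fun i => hx.monotone (Fin.le_def.2 (by simp [i₁]; omega))
  have hab : a < b := (hxI i₀).1.trans (hxI i₀).2
  obtain ⟨c, hc, hcb⟩ := exists_between (hxI i₁).2
  obtain ⟨s, hs, hs_card⟩ := (Set.Ioo_infinite hcb).exists_subset_card_eq (2 * n + 1)
  obtain ⟨r, hr, hr_card⟩ := (Set.Ioo_infinite (hxI i₀).1).exists_subset_card_eq (2 * n)
  have hfw := hf.intervalIntegrable_mul hab hw_int
  set K := (b - a) ^ (2 * n - 1) * (finsetDivDiff f s - finsetDivDiff f (insert a r))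
  set Q := w₀ * f a + ∑ i, wt i * f (x i)
  have key : ∀ᶠ h in nhdsWithin (0 : ℝ) (Set.Ioi 0),
      Q - h * (K * ∫ t in a..b, w t) ≤ ∫ t in a..b, f t * w t := by
    filter_upwards [eventually_add_lt hx fun i => (hi₁ i).trans_lt hc] with h hh
    obtain ⟨h0, hsep, hxc⟩ := hh
    set p := Lagrange.interpolate (doubledNodes a x h) id f with hp
    have hle : ∀ t ∈ Set.Icc a b, -(h * K) ≤ f t - p.eval t := fun t ht =>
      hf.neg_mul_le_sub_eval_interpolate hx (hxI i₀).1 hi₀ ((hi₀ i₁).trans hc.le) hcb h0 hsep hxc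
        hs hs_card hr hr_card ht
    have hnode : ∀ y ∈ doubledNodes a x h, p.eval y = f y := fun y hy =>
      Lagrange.eval_interpolate_at_node (v := id) f Function.injective_id.injOn hy
    have hdeg : p.natDegree ≤ 2 * n := by
      refine Polynomial.natDegree_le_of_degree_le
        ((Lagrange.degree_interpolate_le f Function.injective_id.injOn).trans ?_)
      rw [card_doubledNodes h0 hx hsep fun i => (hxI i).1]
      simp
    have hQ : Q = ∫ t in a..b, p.eval t * w t := by
      rw [← hexact p hdeg, hnode a (mem_doubledNodes.2 (.inl rfl))]
      simp only [hnode _ (mem_doubledNodes.2 (.inr (.inl ⟨_, rfl⟩))), Q]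
    have hpw : IntervalIntegrable (fun t => p.eval t * w t) volume a b :=
      hw_int.continuousOn_mul p.continuous.continuousOn
    have hint : ∫ t in a..b, (p.eval t * w t - h * K * w t) ≤ ∫ t in a..b, f t * w t := by
      refine intervalIntegral.integral_mono_on hab.le (hpw.sub (hw_int.const_mul _)) hfw
        fun t ht => ?_
      have := mul_le_mul_of_nonneg_right (hle t ht) (hw_nonneg t ht)
      linarith
    rw [intervalIntegral.integral_sub hpw (hw_int.const_mul _),
      intervalIntegral.integral_const_mul, ← hQ] at hint
    linarith
  refine le_of_tendsto (Filter.Tendsto.mono_left ?_ nhdsWithin_le_nhds) key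
  have hcont : Continuous fun h : ℝ => Q - h * (K * ∫ t in a..b, w t) := by fun_prop
  simpa using hcont.tendsto 0
end
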